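/- For every p > 1, every d ∈ (-1, 1) and every y ∈ (-1, 1), the function y ↦ κ(d, y) satisfies the stationary equation (1/ρ(y)) · d/dy ( ρ(y) (1 - y²) ∂_y κ(d, y) ) - (2(p+1)/(p-1)²) κ(d, y) + κ(d, y)^p = 0, where ρ(y) = (1 - y²)^{2/(p-1)}. -/

import Mathlib

open Filter Set

/-- The constant `κ₀ = (2(p+1)/(p-1)^2)^{1/(p-1)}`. -/
noncomputable def kappa0 (p : ℝ) : ℝ := (2 * (p + 1) / (p - 1) ^ 2) ^ (1 / (p - 1))

/-- The stationary solutions `κ(d,y) = κ₀ (1-d²)^{1/(p-1)} / (1+dy)^{2/(p-1)}`. -/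
noncomputable def kappa (p d y : ℝ) : ℝ :=
  kappa0 p * (1 - d ^ 2) ^ (1 / (p - 1)) / (1 + d * y) ^ (2 / (p - 1))

/-- The weight `ρ(y) = (1-y²)^{2/(p-1)}`. -/
noncomputable def rho (p y : ℝ) : ℝ := (1 - y ^ 2) ^ (2 / (p - 1))

lemma one_add_mul_pos {d y : ℝ} (hd : d ∈ Set.Ioo (-1 : ℝ) 1) (hy : y ∈ Set.Ioo (-1 : ℝ) 1) :
    0 < 1 + d * y := by
  obtain ⟨h1, h2⟩ := hd
  obtain ⟨h3, h4⟩ := hy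
  nlinarith

lemma one_sub_sq_pos {y : ℝ} (hy : y ∈ Set.Ioo (-1 : ℝ) 1) : 0 < 1 - y ^ 2 := by
  obtain ⟨h1, h2⟩ := hy
  nlinarith

lemma hasDerivAt_kappa (p : ℝ) {d y : ℝ} (hu : 0 < 1 + d * y) :
    HasDerivAt (fun z => kappa p d z) (-(2 / (p - 1) * d * kappa p d y / (1 + d * y))) y := by
  have h1 : HasDerivAt (fun z : ℝ => 1 + d * z) d y := by
    simpa using ((hasDerivAt_id y).const_mul d).const_add 1
  have h2 := h1.rpow_const (p := 2 / (p - 1)) (Or.inl hu.ne')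
  have hpos : 0 < (1 + d * y) ^ (2 / (p - 1)) := Real.rpow_pos_of_pos hu _
  refine ((hasDerivAt_const y (kappa0 p * (1 - d ^ 2) ^ (1 / (p - 1)))).fun_div h2
    hpos.ne').congr_deriv ?_
  rw [Real.rpow_sub_one hu.ne', kappa]
  generalize 2 / (p - 1) = a at *
  generalize (1 + d * y) ^ a = v at *
  field_simp
  ring

lemma hasDerivAt_rho (p : ℝ) {y : ℝ} (hs : 0 < 1 - y ^ 2) :
    HasDerivAt (fun z => rho p z) (-(2 * y * (2 / (p - 1)) * rho p y / (1 - y ^ 2))) y := by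
  have h1 : HasDerivAt (fun z : ℝ => 1 - z ^ 2) (-(2 * y)) y := by
    simpa using (hasDerivAt_pow 2 y).const_sub 1
  refine (h1.rpow_const (p := 2 / (p - 1)) (Or.inl hs.ne')).congr_deriv ?_
  rw [Real.rpow_sub_one hs.ne', rho]
  ring

lemma kappa_rpow {p d y : ℝ} (hp : 1 < p) (hd : 0 < 1 - d ^ 2) (hu : 0 < 1 + d * y) :
    kappa p d y ^ p =
      kappa p d y * (2 * (p + 1) / (p - 1) ^ 2 * (1 - d ^ 2) / (1 + d * y) ^ 2) := by
  have hq : 0 < p - 1 := by linarith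
  have hK : 0 < 2 * (p + 1) / (p - 1) ^ 2 := by positivity
  have h0 : 0 < kappa0 p := Real.rpow_pos_of_pos hK _
  have hc := Real.rpow_pos_of_pos hd (1 / (p - 1))
  have hv := Real.rpow_pos_of_pos hu (2 / (p - 1))
  have hk : 0 < kappa p d y := by unfold kappa; positivity
  have hpow : kappa p d y ^ (p - 1) =
      2 * (p + 1) / (p - 1) ^ 2 * (1 - d ^ 2) / (1 + d * y) ^ 2 := by
    unfold kappa
    rw [Real.div_rpow (by positivity) hv.le, Real.mul_rpow h0.le hc.le, kappa0,
      ← Real.rpow_mul hK.le, ← Real.rpow_mul hd.le, ← Real.rpow_mul hu.le,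
      div_mul_cancel₀ _ hq.ne', div_mul_cancel₀ _ hq.ne', Real.rpow_one, Real.rpow_one,
      Real.rpow_two]
  rw [← hpow, ← Real.rpow_one_add' hk.le (by linarith), add_sub_cancel]

/-- `κ(d,·)` solves the stationary equation
`£κ - (2(p+1)/(p-1)²) κ + κ^p = 0`, where `£w = (1/ρ) ∂_y(ρ (1-y²) ∂_y w)`. -/
theorem stmt_16 (p : ℝ) (hp : 1 < p) :
    ∀ d ∈ Set.Ioo (-1:ℝ) 1, ∀ y ∈ Set.Ioo (-1:ℝ) 1,
      1 / rho p y *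
          deriv (fun y' => rho p y' * (1 - y' ^ 2) * deriv (fun z => kappa p d z) y') y
        - 2 * (p + 1) / (p - 1) ^ 2 * kappa p d y + kappa p d y ^ p = 0 := by
  intro d hd y hy
  have hu := one_add_mul_pos hd hy
  have hs := one_sub_sq_pos hy
  have hq : p - 1 ≠ 0 := by linarith
  have hr : rho p y ≠ 0 := (Real.rpow_pos_of_pos hs _).ne'
  have hev : (fun y' => rho p y' * (1 - y' ^ 2) * deriv (fun z => kappa p d z) y') =ᶠ[nhds y]
      fun y' => rho p y' * (1 - y' ^ 2) *
        (-(2 / (p - 1) * d * kappa p d y' / (1 + d * y'))) := by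
    filter_upwards [isOpen_Ioo.mem_nhds hy] with z hz
    rw [(hasDerivAt_kappa p (one_add_mul_pos hd hz)).deriv]
  have hone : HasDerivAt (fun z : ℝ => 1 + d * z) d y := by
    simpa using ((hasDerivAt_id y).const_mul d).const_add 1
  have hsq : HasDerivAt (fun z : ℝ => 1 - z ^ 2) (-(2 * y)) y := by
    simpa using (hasDerivAt_pow 2 y).const_sub 1
  have hflux := ((hasDerivAt_rho p hs).fun_mul hsq).fun_mul
    ((((hasDerivAt_kappa p hu).const_mul (2 / (p - 1) * d)).fun_div hone hu.ne').fun_neg)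
  rw [hev.deriv_eq, hflux.deriv, kappa_rpow hp (one_sub_sq_pos hd) hu]
  generalize kappa p d y = k
  generalize rho p y = r at *
  have hu' := hu.ne'
  have hs' := hs.ne'
  generalize hU : 1 + d * y = u at hu'
  field_simp
  rw [← hU]
  ring
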